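/- For all integers n ≥ m ≥ 1, [n−1 m−1]_q = Σ_{w ∈ ℳ̄₁(m, n−m+1)} q^{maj(w)}. -/

import Mathlib

open Polynomial Finset

/-- The Gaussian polynomial `[n m]_q`, as a polynomial in `ℤ[q]`
(it vanishes when `m > n`).  It is defined by the `q`-Pascal recursion
`[n m]_q = [n-1 m-1]_q + q^m [n-1 m]_q`. -/
noncomputable def gauss : ℕ → ℕ → Polynomial ℤ
  | _, 0 => 1
  | 0, _ + 1 => 0
  | n + 1, m + 1 => gauss n m + X ^ (m + 1) * gauss n (m + 1)

/-- The `q`-Kaplansky number `K_q(n,m) = ((1-q^(n+m))/(1-q^n))·[n m]_q`,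
defined as the polynomial `[n-1 m-1]_q + q^m·[n m]_q`. -/
noncomputable def kap (n : ℕ) : ℕ → Polynomial ℤ
  | 0 => 1
  | m + 1 => gauss (n - 1) m + X ^ (m + 1) * gauss n (m + 1)

/-- The number of ones of a (0,1)-sequence. -/
def numOnes {N : ℕ} (w : Fin N → Bool) : ℕ :=
  (Finset.univ.filter fun i => w i = true).card

/-- The inversion number of a (0,1)-sequence: the number of pairs `(i,j)`
with `i < j`, `w i = 1` and `w j = 0`. -/
def invW {N : ℕ} (w : Fin N → Bool) : ℕ :=
  ((Finset.univ : Finset (Fin N × Fin N)).filter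
    fun p => p.1 < p.2 ∧ w p.1 = true ∧ w p.2 = false).card

/-- The major index of a (0,1)-sequence: the sum of the (1-based) positions `i`
with `w_i > w_(i+1)`. -/
def majW {N : ℕ} (w : Fin N → Bool) : ℕ :=
  ∑ i : Fin N,
    if h : (i : ℕ) + 1 < N then
      (if w i = true ∧ w ⟨(i : ℕ) + 1, h⟩ = false then (i : ℕ) + 1 else 0)
    else 0

theorem ite_cg {P Q : Prop} {dP : Decidable P} {dQ : Decidable Q} (a b : Polynomial ℤ)
    (h : P ↔ Q) : (if P then a else b) = (if Q then a else b) := if_congr h rfl rfl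

theorem gauss_zero_right (n : ℕ) : gauss n 0 = 1 := by cases n <;> simp [gauss]

theorem gauss_ss (n m : ℕ) :
    gauss (n + 1) (m + 1) = gauss n m + X ^ (m + 1) * gauss n (m + 1) := by simp [gauss]

theorem gauss_gt (n : ℕ) : ∀ m, n < m → gauss n m = 0 := by
  induction n with
  | zero => intro m h; cases m with
    | zero => omega
    | succ m => simp [gauss]
  | succ n ih => intro m h; cases m with
    | zero => omega
    | succ m => rw [gauss_ss, ih m (by omega), ih (m + 1) (by omega)]; simp

theorem gauss_ratio (N : ℕ) : ∀ m k, m + k = N →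
    (1 - X ^ k) * gauss N m = (1 - X ^ (m + 1)) * gauss N (m + 1) := by
  induction N with
  | zero =>
    intro m k h
    obtain ⟨rfl, rfl⟩ : m = 0 ∧ k = 0 := by omega
    simp [gauss]
  | succ N ih =>
    intro m k h
    rcases k with _ | k
    · rw [gauss_gt (N + 1) (m + 1) (by omega)]; simp
    rcases m with _ | m
    · have h1 := ih 0 k (by omega)
      rw [gauss_ss, gauss_zero_right]
      rw [gauss_zero_right] at h1 ⊢
      linear_combination X * h1
    · have h1 := ih m (k + 1) (by omega)
      have h2 := ih (m + 1) k (by omega)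
      rw [gauss_ss, gauss_ss]
      linear_combination h1 + X ^ (m + 2) * h2

theorem gauss_pascal2 (N m : ℕ) (h : m ≤ N) :
    X ^ (m + 1) * gauss N (m + 1) + X ^ (N + 1) * gauss N m
      = X ^ (m + 1) * gauss (N + 1) (m + 1) := by
  obtain ⟨k, rfl⟩ := Nat.exists_eq_add_of_le h
  have := gauss_ratio (m + k) m k rfl
  rw [gauss_ss]
  linear_combination (-X ^ (m + 1)) * this

def sn {N : ℕ} (v : Fin N → Bool) (b : Bool) : Fin (N + 1) → Bool :=
  Fin.snoc (α := fun _ => Bool) v b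

theorem sn_castSucc {N : ℕ} (v : Fin N → Bool) (b : Bool) (i : Fin N) :
    sn v b i.castSucc = v i := by simp [sn]

theorem sn_last {N : ℕ} (v : Fin N → Bool) (b : Bool) :
    sn v b (Fin.last N) = b := by simp [sn]

theorem sn_lt {N : ℕ} (v : Fin N → Bool) (b : Bool) (i : ℕ) (h : i < N) (h' : i < N + 1) :
    sn v b ⟨i, h'⟩ = v ⟨i, h⟩ := sn_castSucc v b ⟨i, h⟩

theorem sn_eq {N : ℕ} (v : Fin N → Bool) (b : Bool) (h' : N < N + 1) :
    sn v b ⟨N, h'⟩ = b := sn_last v b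

theorem sum_sn {N : ℕ} (f : (Fin (N + 1) → Bool) → Polynomial ℤ) :
    ∑ w, f w = ∑ v, f (sn v true) + ∑ v, f (sn v false) := by
  rw [← (Fin.snocEquiv (fun _ : Fin (N + 1) => Bool)).sum_comp, Fintype.sum_prod_type]
  simp [sn, Fin.snocEquiv]

theorem numOnes_sn {N : ℕ} (v : Fin N → Bool) (b : Bool) :
    numOnes (sn v b) = numOnes v + (if b = true then 1 else 0) := by
  unfold numOnes
  rw [Finset.card_filter, Finset.card_filter, Fin.sum_univ_castSucc]
  simp [sn_castSucc, sn_last]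

theorem majW_sn_true {N : ℕ} (v : Fin N → Bool) : majW (sn v true) = majW v := by
  unfold majW
  rw [Fin.sum_univ_castSucc]
  simp only [Fin.val_last, lt_irrefl, dite_false, add_zero, Fin.val_castSucc]
  refine Finset.sum_congr rfl fun i _ => ?_
  rw [dif_pos (by omega), sn_castSucc]
  by_cases h : (i : ℕ) + 1 < N
  · rw [dif_pos h, sn_lt _ _ _ h]
  · rw [dif_neg h]
    have : (⟨(i : ℕ) + 1, by omega⟩ : Fin (N + 1)) = Fin.last N := by ext; simp; omega
    rw [this, sn_last]; simp

theorem majW_sn_false {N : ℕ} (v : Fin N → Bool) (b : Bool) :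
    majW (sn (sn v b) false) = majW (sn v b) + (if b = true then N + 1 else 0) := by
  unfold majW
  rw [Fin.sum_univ_castSucc, Fin.sum_univ_castSucc, Fin.sum_univ_castSucc]
  simp only [Fin.val_last, lt_irrefl, dite_false, add_zero, Fin.val_castSucc]
  congr 1
  · refine Finset.sum_congr rfl fun i _ => ?_
    rw [dif_pos (by omega), dif_pos (by omega), sn_castSucc, sn_lt (sn v b) false _ (by omega)]
  · rw [dif_pos (by omega), sn_castSucc, sn_last, sn_eq]; simp

def Cnd {N : ℕ} (w : Fin N → Bool) : Prop :=
  ∀ t : Fin N, w t = false → (∀ j : Fin N, t < j → w j = true) →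
    ((t : ℕ) = 0 ∨ w ⟨(t : ℕ) - 1, lt_of_le_of_lt (Nat.sub_le _ _) t.isLt⟩ = false)

theorem Cnd_sn_true {N : ℕ} (v : Fin N → Bool) : Cnd (sn v true) ↔ Cnd v := by
  unfold Cnd
  rw [Fin.forall_fin_succ']
  simp only [sn_castSucc, sn_last, Fin.val_castSucc]
  simp only [Fin.forall_fin_succ', sn_castSucc, sn_last, Fin.castSucc_lt_castSucc_iff]
  simp only [Bool.true_eq_false, false_implies, and_true, implies_true]
  refine forall_congr' fun t => ?_
  rw [sn_lt _ _ _ (by omega)]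

theorem Cnd_sn_false {N : ℕ} (v : Fin N → Bool) (b : Bool) :
    Cnd (sn (sn v b) false) ↔ b = false := by
  constructor
  · intro h
    have := h (Fin.last _) (sn_last _ _) (fun j hj => absurd hj (not_lt.2 (Fin.le_last j)))
    rcases this with h | h
    · simp at h
    · simp only [Fin.val_last, Nat.add_sub_cancel] at h
      rwa [sn_lt _ _ _ (by omega), sn_eq] at h
  · intro hb t ht hj
    subst hb
    by_cases h : t = Fin.last _
    · right; subst h
      simp only [Fin.val_last, Nat.add_sub_cancel]
      rw [sn_lt _ _ _ (by omega), sn_eq]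
    · have := hj (Fin.last _) (Fin.lt_last_iff_ne_last.2 h)
      rw [sn_last] at this; simp at this

noncomputable def PP (b : Bool) (N m : ℕ) : Polynomial ℤ :=
  ∑ v : Fin N → Bool, if numOnes v = m then X ^ majW (sn v b) else 0

open Classical in
noncomputable def HH (N m : ℕ) : Polynomial ℤ :=
  ∑ v : Fin N → Bool, if numOnes v = m ∧ Cnd v then X ^ majW v else 0

theorem PP_zero (b : Bool) (m : ℕ) : PP b 0 m = gauss 0 m := by
  cases m <;> simp [PP, numOnes, majW, gauss]

theorem PP_eq (N : ℕ) : ∀ m, PP true N m = gauss N m ∧ PP false N m = X ^ m * gauss N m := by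
  induction N with
  | zero =>
    intro m
    rw [PP_zero, PP_zero]
    cases m <;> simp [gauss]
  | succ N ih =>
    intro m
    rcases m with _ | m
    · have h1 : PP true (N + 1) 0 = PP false N 0 := by
        simp [PP, sum_sn, numOnes_sn, majW_sn_true]
      have h2 : PP false (N + 1) 0 = PP false N 0 := by
        simp [PP, sum_sn, numOnes_sn, majW_sn_false]
      rw [h1, h2, (ih 0).2]; simp [gauss_zero_right]
    · have h1 : PP true (N + 1) (m + 1) = PP true N m + PP false N (m + 1) := by
        simp [PP, sum_sn, numOnes_sn, majW_sn_true]
      have h2 : PP false (N + 1) (m + 1) = X ^ (N + 1) * PP true N m + PP false N (m + 1) := by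
        simp [PP, sum_sn, numOnes_sn, majW_sn_false, pow_add, Finset.mul_sum, mul_comm]
      rw [h1, h2, (ih m).1, (ih (m + 1)).2]
      refine ⟨(gauss_ss N m).symm, ?_⟩
      by_cases h : m ≤ N
      · rw [← gauss_pascal2 N m h, add_comm]
      · rw [gauss_gt N m (by omega), gauss_gt N (m + 1) (by omega),
          gauss_gt (N + 1) (m + 1) (by omega)]; simp

theorem HH_eq (n : ℕ) : ∀ m, m ≤ n → HH (n + 1) m = gauss n m := by
  induction n with
  | zero =>
    intro m h
    obtain rfl : m = 0 := by omega
    simp [HH, sum_sn, numOnes_sn, gauss]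
    rw [if_pos]
    · simp [majW]
    · refine ⟨by rw [numOnes_sn]; simp [numOnes], fun t _ _ => Or.inl (by omega)⟩
  | succ n ih =>
    intro m h
    rcases m with _ | m
    · have : HH (n + 1 + 1) 0 = PP false n 0 := by
        unfold HH
        rw [sum_sn, sum_sn (N := n), sum_sn (N := n)]
        simp [PP, numOnes_sn, majW_sn_false, Cnd_sn_false]
      rw [this, (PP_eq n 0).2]; simp [gauss_zero_right]
    · have : HH (n + 1 + 1) (m + 1) = HH (n + 1) m + PP false n (m + 1) := by
        unfold HH
        rw [sum_sn]
        congr 1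
        · refine Finset.sum_congr rfl fun v _ => ?_
          rw [majW_sn_true]
          apply ite_cg
          rw [numOnes_sn, Cnd_sn_true]; simp
        · rw [sum_sn]
          simp [PP, numOnes_sn, majW_sn_false, Cnd_sn_false]
      rw [this, ih m (by omega), (PP_eq n _).2, gauss_ss]

/-- For `n ≥ m ≥ 1`, `[n-1 m-1]_q` is the generating function for
the major index over the set `ℳ̄₁(m, n-m+1)` of (0,1)-sequences of length `n+1`
with `m` ones and `n-m+1` zeros whose last entry is `1` and such that if `t` is the
(1-based) position of the last zero then `t = 1` or `w_(t-1) = 0`.  (Below positions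
are 0-based, so the condition reads: for the maximal position `t` with `w t = 0`,
either `t = 0` or `w (t-1) = 0`.) -/
theorem gauss_eq_sum_maj_M1bar (n m : ℕ) (hm : 1 ≤ m) (hmn : m ≤ n) :
    gauss (n - 1) (m - 1) =
      ∑ w ∈ (Finset.univ : Finset (Fin (n + 1) → Bool)).filter
          (fun w => numOnes w = m ∧ w (Fin.last n) = true ∧
            (∀ t : Fin (n + 1), w t = false →
              (∀ j : Fin (n + 1), t < j → w j = true) →
                ((t : ℕ) = 0 ∨
                  w ⟨(t : ℕ) - 1, lt_of_le_of_lt (Nat.sub_le _ _) t.isLt⟩ = false))),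
        X ^ majW w := by
  obtain ⟨m, rfl⟩ := Nat.exists_eq_add_of_le' hm
  obtain ⟨n, rfl⟩ : ∃ k, n = k + 1 := ⟨n - 1, by omega⟩
  rw [Nat.add_sub_cancel, Nat.add_sub_cancel, ← HH_eq n m (by omega), Finset.sum_filter, sum_sn]
  rw [← add_zero (HH (n + 1) m)]
  congr 1
  · refine Finset.sum_congr rfl fun v _ => ?_
    rw [majW_sn_true]
    apply ite_cg
    change _ ↔ numOnes (sn v true) = m + 1 ∧ sn v true (Fin.last _) = true ∧ Cnd (sn v true)
    rw [numOnes_sn, Cnd_sn_true, sn_last]; simp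
  · symm
    refine Finset.sum_eq_zero fun v _ => if_neg fun h => ?_
    have := h.2.1
    rw [sn_last] at this
    simp at this
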